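/- Let A(k) be the collection of alternatives {(c/k, d/k) : c, d ∈ ℕ, c + d ≤ k}. For every k ≥ 1 and every 0 < δ ≤ 1, every pure Nash equilibrium outcome (o₁, o₂) of the game Γ_{SA_δ}(A(k)) lies within sup-norm distance δ + 1/k of the segment joining (x, 1−x) and (1−x, x), where x is the unique solution in [0, 1/2] of x³ − x + 1/3 = 0; that is, there exists a point p on that segment with max(|o₁ − p₁|, |o₂ − p₂|) ≤ δ + 1/k. -/

import Mathlib

open Finset

attribute [local instance] Classical.propDecidable

/-- Average of the alternatives over a finite set of indices. -/
noncomputable def avg {ι : Type*} [Fintype ι] (a : ι → ℝ × ℝ) (S : Finset ι) : ℝ × ℝ :=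
  (S.card : ℝ)⁻¹ • ∑ k ∈ S, a k

/-- The expected pair of payoffs in the satisfactory-alternatives mechanism `SA_δ`
when the players submit the sets `L₁`, `L₂`. -/
noncomputable def SAout {ι : Type*} [Fintype ι] (a : ι → ℝ × ℝ) (δ : ℝ)
    (L₁ L₂ : Finset ι) : ℝ × ℝ :=
  if L₁ ∩ L₂ = ∅ then
    (if L₁ ∪ L₂ = ∅ then avg a Finset.univ else avg a (L₁ ∪ L₂))
  else (1 - δ) • avg a (L₁ ∩ L₂) + δ • avg a (L₁ ∪ L₂)

/-- `(L₁, L₂)` is a pure Nash equilibrium of the game `Γ_{SA_δ}(A)`. -/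
def IsPureNE {ι : Type*} [Fintype ι] (a : ι → ℝ × ℝ) (δ : ℝ) (L₁ L₂ : Finset ι) : Prop :=
  (∀ L₁' : Finset ι, (SAout a δ L₁' L₂).1 ≤ (SAout a δ L₁ L₂).1) ∧
  (∀ L₂' : Finset ι, (SAout a δ L₁ L₂').2 ≤ (SAout a δ L₁ L₂).2)

/-- The index set of the splitting-the-pie collection `A(k)`:
pairs `(c,d)` of naturals with `c + d ≤ k`. -/
def PieIndex (k : ℕ) : Type :=
  {p : Fin (k+1) × Fin (k+1) // (p.1 : ℕ) + (p.2 : ℕ) ≤ k}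

noncomputable instance (k : ℕ) : Fintype (PieIndex k) := by
  unfold PieIndex; infer_instance

/-- The splitting-the-pie collection `A(k) = {(c/k, d/k) : c + d ≤ k}`. -/
noncomputable def pieColl (k : ℕ) : PieIndex k → ℝ × ℝ :=
  fun p => (((p.1.1 : ℕ) : ℝ) / k, ((p.1.2 : ℕ) : ℝ) / k)

/-- Scalar average. -/
noncomputable def savg {ι : Type*} (v : ι → ℝ) (S : Finset ι) : ℝ :=
  (S.card : ℝ)⁻¹ * ∑ p ∈ S, v p

/-- The intersection part of the payoff. -/
noncomputable def swt {ι : Type*} (v : ι → ℝ) (S T : Finset ι) : ℝ :=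
  if S ∩ T = ∅ then savg v (S ∪ T) else savg v (S ∩ T)

/-- Scalar payoff. -/
noncomputable def sval {ι : Type*} [Fintype ι] (v : ι → ℝ) (δ : ℝ) (S T : Finset ι) : ℝ :=
  if S ∪ T = ∅ then savg v Finset.univ else (1 - δ) * swt v S T + δ * savg v (S ∪ T)

theorem SAout_fst {ι : Type*} [Fintype ι] (a : ι → ℝ × ℝ) (δ : ℝ) (S T : Finset ι) :
    (SAout a δ S T).1 = sval (fun p => (a p).1) δ S T := by
  have hU : ∀ W : Finset ι, (avg a W).1 = savg (fun p => (a p).1) W := by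
    intro W; simp [avg, savg, Prod.fst_sum]
  unfold SAout sval swt
  by_cases h2 : S ∪ T = ∅
  · have h1 : S ∩ T = ∅ := by
      rw [Finset.union_eq_empty] at h2; simp [h2.1]
    simp [h1, h2, hU]
  · by_cases h1 : S ∩ T = ∅
    · rw [if_pos h1, if_neg h2, if_neg h2, if_pos h1, hU]; ring
    · rw [if_neg h1, if_neg h2, if_neg h1]; simp [hU]

theorem SAout_snd {ι : Type*} [Fintype ι] (a : ι → ℝ × ℝ) (δ : ℝ) (S T : Finset ι) :
    (SAout a δ S T).2 = sval (fun p => (a p).2) δ T S := by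
  have hU : ∀ W : Finset ι, (avg a W).2 = savg (fun p => (a p).2) W := by
    intro W; simp [avg, savg, Prod.snd_sum]
  unfold SAout sval swt
  rw [Finset.union_comm T S, Finset.inter_comm T S]
  by_cases h2 : S ∪ T = ∅
  · have h1 : S ∩ T = ∅ := by
      rw [Finset.union_eq_empty] at h2; simp [h2.1]
    simp [h1, h2, hU]
  · by_cases h1 : S ∩ T = ∅
    · rw [if_pos h1, if_neg h2, if_neg h2, if_pos h1, hU]; ring
    · rw [if_neg h1, if_neg h2, if_neg h1]; simp [hU]

theorem savg_mul {ι : Type*} (v : ι → ℝ) (S : Finset ι) (hS : S ≠ ∅) :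
    S.card * savg v S = ∑ p ∈ S, v p := by
  unfold savg
  have : (S.card : ℝ) ≠ 0 := by
    simpa using hS
  field_simp

theorem card_pos_real {ι : Type*} (S : Finset ι) (hS : S ≠ ∅) : (0:ℝ) < S.card := by
  have := Finset.card_pos.2 (Finset.nonempty_iff_ne_empty.2 hS)
  exact_mod_cast this

theorem savg_sum_sub {ι : Type*} (v : ι → ℝ) (S : Finset ι) (hS : S ≠ ∅) :
    ∑ p ∈ S, (v p - savg v S) = 0 := by
  rw [Finset.sum_sub_distrib, ← savg_mul v S hS]; simp

theorem savg_insert_lt {ι : Type*} (v : ι → ℝ) (S : Finset ι) (hS : S ≠ ∅) (p : ι) (hp : p ∉ S)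
    (h : savg v S < v p) : savg v S < savg v (insert p S) := by
  have h1 := savg_mul v S hS
  have h2 := savg_mul v (insert p S) (Finset.insert_ne_empty _ _)
  rw [Finset.sum_insert hp, Finset.card_insert_of_notMem hp, ← h1] at h2
  push_cast at h2
  have hc := card_pos_real S hS
  by_contra hcon
  push Not at hcon
  nlinarith

theorem savg_erase_lt {ι : Type*} (v : ι → ℝ) (S : Finset ι) (p : ι) (hp : p ∈ S)
    (hS : S.erase p ≠ ∅)
    (h : v p < savg v S) : savg v S < savg v (S.erase p) := by
  have h1 := savg_mul v S (Finset.ne_empty_of_mem hp)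
  have h2 := savg_mul v (S.erase p) hS
  have h3 := Finset.add_sum_erase S v hp
  have h4 := Finset.card_erase_add_one hp
  have h5 : ((S.erase p).card : ℝ) + 1 = S.card := by exact_mod_cast h4
  rw [← h3, ← h2, ← h5] at h1
  have hc := card_pos_real _ hS
  by_contra hcon
  push Not at hcon
  nlinarith

theorem savg_singleton {ι : Type*} (v : ι → ℝ) (p : ι) : savg v {p} = v p := by
  simp [savg]

theorem savg_nonneg {ι : Type*} (v : ι → ℝ) (hv : ∀ p, 0 ≤ v p) (S : Finset ι) :
    0 ≤ savg v S := by
  unfold savg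
  exact mul_nonneg (by positivity) (Finset.sum_nonneg fun p _ => hv p)

theorem savg_pos {ι : Type*} (v : ι → ℝ) (hv : ∀ p, 0 ≤ v p) (S : Finset ι) (p : ι)
    (hp : p ∈ S) (h : 0 < v p) : 0 < savg v S := by
  unfold savg
  have := card_pos_real S (Finset.ne_empty_of_mem hp)
  have h2 : 0 < ∑ p ∈ S, v p := Finset.sum_pos' (fun q _ => hv q) ⟨p, hp, h⟩
  positivity

theorem swt_nonneg {ι : Type*} (v : ι → ℝ) (hv : ∀ p, 0 ≤ v p) (S T : Finset ι) :
    0 ≤ swt v S T := by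
  unfold swt
  split_ifs <;> exact savg_nonneg v hv _

theorem sval_nonneg {ι : Type*} [Fintype ι] (v : ι → ℝ) (hv : ∀ p, 0 ≤ v p) (δ : ℝ) (h0 : 0 < δ)
    (h1 : δ ≤ 1) (S T : Finset ι) : 0 ≤ sval v δ S T := by
  unfold sval
  split_ifs
  · exact savg_nonneg v hv _
  · have := swt_nonneg v hv S T
    have := savg_nonneg v hv (S ∪ T)
    have : 0 ≤ 1 - δ := by linarith
    positivity

theorem sval_add_le {ι : Type*} [Fintype ι] (v w : ι → ℝ) (hvw : ∀ p, v p + w p ≤ 1) (δ : ℝ)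
    (h0 : 0 < δ)
    (h1 : δ ≤ 1) (S T : Finset ι) : sval v δ S T + sval w δ T S ≤ 1 := by
  have key : ∀ W : Finset ι, savg v W + savg w W ≤ 1 := by
    intro W
    by_cases hW : W = ∅
    · subst hW; simp [savg]
    · have hc := card_pos_real W hW
      unfold savg
      rw [← mul_add, ← Finset.sum_add_distrib, inv_mul_le_iff₀ hc]
      calc _ ≤ ∑ p ∈ W, (1:ℝ) := Finset.sum_le_sum fun p _ => hvw p
        _ = _ := by simp
  unfold sval swt
  rw [Finset.union_comm T S, Finset.inter_comm T S]
  have e1 := key Finset.univ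
  have e2 := key (S ∪ T)
  have e3 := key (S ∩ T)
  split_ifs
  · exact e1
  · nlinarith
  · nlinarith

theorem T_nonempty {ι : Type*} [Fintype ι] (v w : ι → ℝ) (hv : ∀ p, 0 ≤ w p)
    (hvw : ∀ p, v p + w p ≤ 1) (δ : ℝ) (h0 : 0 < δ) (h1 : δ ≤ 1) (S T : Finset ι)
    (p q : ι) (hp : v p = 1) (hq : 0 < w q)
    (hS : ∀ S', sval v δ S' T ≤ sval v δ S T) (hT : ∀ T', sval w δ T' S ≤ sval w δ T S) :
    T ≠ ∅ := by
  rintro rfl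
  have a1 := hS {p}
  have a2 := hT {q}
  have a3 := sval_add_le v w hvw δ h0 h1 S ∅
  have a4 : sval v δ {p} ∅ = 1 := by
    simp [sval, swt, savg_singleton, hp]
  have a5 : 0 < sval w δ {q} S := by
    have hq' : q ∈ {q} ∪ S := by simp
    unfold sval
    rw [if_neg (Finset.ne_empty_of_mem hq')]
    have := swt_nonneg w hv {q} S
    have := savg_pos w hv _ q hq' hq
    have : 0 ≤ 1 - δ := by linarith
    positivity
  linarith

theorem best_response {ι : Type*} [Fintype ι] (v : ι → ℝ) (δ : ℝ) (h0 : 0 < δ) (h1 : δ < 1)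
    (S T : Finset ι) (hT : T ≠ ∅) (hS : ∀ S', sval v δ S' T ≤ sval v δ S T) :
    savg v (S ∪ T) ≤ swt v S T ∧ (∀ p, savg v (S ∪ T) < v p → p ∈ S ∪ T) ∧
    (∀ p ∈ S, savg v (S ∪ T) ≤ v p) ∧ (∀ p ∈ T, v p ≤ swt v S T) := by
  have hne : ∀ S', S' ∪ T ≠ ∅ := by
    intro S' h
    exact hT (Finset.union_eq_empty.1 h).2
  have hval : ∀ S', (1 - δ) * swt v S' T + δ * savg v (S' ∪ T) ≤
      (1 - δ) * swt v S T + δ * savg v (S ∪ T) := by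
    intro S'
    have := hS S'
    unfold sval at this
    rwa [if_neg (hne _), if_neg (hne _)] at this
  have hd : 0 < 1 - δ := by linarith
  have c1 : savg v (S ∪ T) ≤ swt v S T := by
    have := hval (S \ T)
    have e1 : (S \ T) ∪ T = S ∪ T := by simp
    have e2 : (S \ T) ∩ T = ∅ := by simp
    rw [e1] at this
    have e3 : swt v (S \ T) T = savg v (S ∪ T) := by
      unfold swt; rw [if_pos e2, e1]
    rw [e3] at this
    nlinarith
  have c4 : ∀ p ∈ T, v p ≤ swt v S T := by
    intro p hp
    have := hval (insert p (S \ T))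
    have e1 : insert p (S \ T) ∪ T = S ∪ T := by
      ext q; simp only [Finset.mem_union, Finset.mem_insert, Finset.mem_sdiff]
      by_cases hq : q ∈ T
      · simp [hq]
      · have : q ≠ p := fun h => hq (h ▸ hp)
        simp [hq, this]
    have e2 : insert p (S \ T) ∩ T = {p} := by
      ext q
      simp only [Finset.mem_inter, Finset.mem_insert, Finset.mem_sdiff, Finset.mem_singleton]
      constructor
      · rintro ⟨h | h, h'⟩
        · exact h
        · exact absurd h' h.2
      · rintro rfl; exact ⟨Or.inl rfl, hp⟩
    have e3 : swt v (insert p (S \ T)) T = v p := by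
      unfold swt; rw [e2, if_neg (Finset.singleton_ne_empty p), savg_singleton]
    rw [e1, e3] at this
    nlinarith
  refine ⟨c1, ?_, ?_, c4⟩
  · intro p hp
    by_contra hpU
    have := hval (insert p S)
    have e1 : insert p S ∪ T = insert p (S ∪ T) := by simp
    have hpT : p ∉ T := fun h => hpU (Finset.mem_union_right _ h)
    have e2 : insert p S ∩ T = S ∩ T := Finset.insert_inter_of_notMem hpT
    have e4 := savg_insert_lt v _ (hne S) p hpU hp
    have e3 : swt v S T ≤ swt v (insert p S) T := by
      unfold swt; rw [e2, e1]; split_ifs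
      · exact e4.le
      · exact le_rfl
    rw [e1] at this
    nlinarith
  · intro p hp
    by_cases hpT : p ∈ T
    · have hI : p ∈ S ∩ T := Finset.mem_inter.2 ⟨hp, hpT⟩
      have e : swt v S T = savg v (S ∩ T) := by
        unfold swt; rw [if_neg (Finset.ne_empty_of_mem hI)]
      have hs := savg_sum_sub v (S ∩ T) (Finset.ne_empty_of_mem hI)
      have hz := (Finset.sum_eq_zero_iff_of_nonpos (fun q hq => by
        have := c4 q (Finset.mem_inter.1 hq).2
        rw [e] at this; linarith)).1 hs p hI
      rw [e] at c1; linarith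
    · by_contra hlt
      push Not at hlt
      have := hval (S.erase p)
      have e1 : S.erase p ∪ T = (S ∪ T).erase p := by
        rw [Finset.erase_union_distrib, Finset.erase_eq_of_notMem hpT]
      have e2 : S.erase p ∩ T = S ∩ T := by
        rw [Finset.erase_inter, Finset.erase_eq_of_notMem]
        simp [hpT]
      have e4 := savg_erase_lt v (S ∪ T) p (Finset.mem_union_left _ hp) (e1 ▸ hne _) hlt
      have e3 : swt v S T ≤ swt v (S.erase p) T := by
        unfold swt; rw [e2, e1]; split_ifs
        · exact e4.le
        · exact le_rfl
      rw [e1] at this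
      nlinarith

theorem sum_closed (K α : ℝ) (n : ℕ) : ∑ c ∈ Finset.range n, (K - c) * (c - α) =
    - n * K * α + (K + α) * (n * (n - 1) / 2) - (n - 1) * n * (2 * n - 1) / 6 := by
  induction n with
  | zero => simp
  | succ n ih => rw [Finset.sum_range_succ, ih]; push_cast; ring

theorem sum_closed2 (α : ℝ) (n : ℕ) : ∑ c ∈ Finset.range n, (α - c) =
    n * α - n * (n - 1) / 2 := by
  induction n with
  | zero => simp
  | succ n ih => rw [Finset.sum_range_succ, ih]; push_cast; ring

theorem core_bound {ι : Type*} [Fintype ι] (k : ℕ) (hk : 1 ≤ k) (f g : ι → ℕ)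
    (H : ∀ F : ℕ → ℕ → ℝ, ∑ p, F (f p) (g p) =
      ∑ c ∈ Finset.range (k + 1), ∑ d ∈ Finset.range (k + 1 - c), F c d)
    (x : ℝ) (hx : x ∈ Set.Icc (0:ℝ) (1/2)) (hroot : x ^ 3 - x + 1/3 = 0)
    (U : Finset ι) (α β : ℝ) (hα : 0 ≤ α) (hab : α ≤ β)
    (h1 : ∑ p ∈ U, ((f p : ℝ) - α) = 0) (h2 : ∀ p, α < f p → p ∈ U)
    (h3 : ∀ p ∈ U, α ≤ f p ∨ β ≤ g p) : x * k - 1 ≤ α := by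
  by_contra hcon
  push Not at hcon
  obtain ⟨hx0, hx1⟩ := hx
  have hkR : (1:ℝ) ≤ k := by exact_mod_cast hk
  set m := ⌈α⌉₊ with hm
  have hm1 : α ≤ m := Nat.le_ceil α
  have hm2 : (m:ℝ) < α + 1 := Nat.ceil_lt_add_one hα
  have hlt : ∀ c : ℕ, c < m ↔ (c:ℝ) < α := fun c => Nat.lt_ceil
  have h2m : 2 * m ≤ k := by
    have : (2:ℝ) * m ≤ k := by nlinarith
    exact_mod_cast this
  have A : ∑ p, ((f p : ℝ) - α) + ∑ p, (if f p < m ∧ g p < m then α - (f p : ℝ) else 0) ≤ 0 := by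
    rw [← Finset.sum_add_distrib, ← Finset.sum_filter_add_sum_filter_not Finset.univ (· ∈ U)]
    have : Finset.univ.filter (· ∈ U) = U := by ext; simp
    rw [this]
    have B1 : ∑ p ∈ U, ((f p : ℝ) - α + if f p < m ∧ g p < m then α - (f p : ℝ) else 0) =
        ∑ p ∈ U, ((f p : ℝ) - α) := by
      apply Finset.sum_congr rfl
      intro p hp
      rw [if_neg, add_zero]
      rintro ⟨a, b⟩
      rw [hlt] at a b
      rcases h3 p hp with h | h <;> linarith
    have B2 : ∑ p ∈ Finset.univ.filter (fun p => ¬ p ∈ U),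
        ((f p : ℝ) - α + if f p < m ∧ g p < m then α - (f p : ℝ) else 0) ≤ 0 := by
      apply Finset.sum_nonpos
      intro p hp
      have hpU : p ∉ U := by simpa using hp
      have : (f p : ℝ) ≤ α := by
        by_contra h
        push Not at h
        exact hpU (h2 p h)
      split_ifs <;> linarith
    linarith
  rw [H (fun c d => (c:ℝ) - α), H (fun c d => if c < m ∧ d < m then α - (c:ℝ) else 0)] at A
  have C1 : ∑ c ∈ Finset.range (k + 1), ∑ d ∈ Finset.range (k + 1 - c), ((c:ℝ) - α) =
      ∑ c ∈ Finset.range (k + 1), (((k:ℝ) + 1) - c) * (c - α) := by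
    apply Finset.sum_congr rfl
    intro c hc
    rw [Finset.mem_range] at hc
    rw [Finset.sum_const, Finset.card_range, nsmul_eq_mul, Nat.cast_sub hc.le]
    push_cast; ring
  have C2 : ∑ c ∈ Finset.range (k + 1), ∑ d ∈ Finset.range (k + 1 - c),
      (if c < m ∧ d < m then α - (c:ℝ) else 0) = ∑ c ∈ Finset.range m, m * (α - (c:ℝ)) := by
    rw [← Finset.sum_subset (Finset.range_subset_range.2 (show m ≤ k + 1 by omega))]
    · apply Finset.sum_congr rfl
      intro c hc
      rw [Finset.mem_range] at hc
      rw [← Finset.sum_subset (Finset.range_subset_range.2 (show m ≤ k + 1 - c by omega))]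
      · rw [Finset.sum_congr rfl (g := fun _ => α - (c:ℝ))]
        · rw [Finset.sum_const, Finset.card_range, nsmul_eq_mul]
        · intro d hd
          rw [Finset.mem_range] at hd
          simp [hc, hd]
      · intro d _ hd
        rw [Finset.mem_range] at hd
        simp [hd]
    · intro c _ hc
      rw [Finset.mem_range] at hc
      simp [hc]
  rw [C1, C2, sum_closed, ← Finset.mul_sum, sum_closed2] at A
  push_cast at A
  have D : α * (α + 1) / 2 ≤ m * α - m * ((m:ℝ) - 1) / 2 := by
    nlinarith [mul_nonneg (sub_nonneg.2 hm1) (sub_nonneg.2 hm2.le)]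
  have D2 : α * (α * (α + 1) / 2) ≤ m * (m * α - m * ((m:ℝ) - 1) / 2) :=
    mul_le_mul hm1 D (by positivity) (by positivity)
  have E : α * (α * (α + 1)) ≤ ((k:ℝ) + 1) * (k + 2) * (α - k / 3) := by
    nlinarith
  clear A C1 C2 H D D2
  obtain ⟨e, rfl⟩ : ∃ e, α = e - 1 := ⟨α + 1, by ring⟩
  generalize (k:ℝ) = K at *
  have he : e < x * K := by linarith
  have he1 : 1 ≤ e := by linarith
  have he2 : e ≤ K / 2 := by nlinarith
  have G : K ^ 2 * e - K ^ 3 / 3 - e ^ 3 < 0 := by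
    have : K ^ 2 * e - K ^ 3 / 3 - e ^ 3 =
        -((x * K - e) * (K ^ 2 - ((x * K) ^ 2 + x * K * e + e ^ 2))) := by
      linear_combination (-K ^ 3) * hroot
    rw [this]
    have hy : x * K ≤ K / 2 := by nlinarith
    have : 0 < K ^ 2 - ((x * K) ^ 2 + x * K * e + e ^ 2) := by
      generalize x * K = y at *
      nlinarith
    have := mul_pos (sub_pos.2 he) this
    linarith
  have G2 : -2 * K ^ 2 + 3 * K * e + 2 * e ^ 2 - 11 * K / 3 + e - 2 < 0 := by nlinarith
  nlinarith

theorem pie_sum (k : ℕ) (F : ℕ → ℕ → ℝ) : ∑ p : PieIndex k, F (p.1.1 : ℕ) (p.1.2 : ℕ) =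
      ∑ c ∈ Finset.range (k + 1), ∑ d ∈ Finset.range (k + 1 - c), F c d := by
  rw [Finset.sum_sigma']
  refine Finset.sum_bij (fun p _ => ⟨(p.1.1 : ℕ), (p.1.2 : ℕ)⟩) ?_ ?_ ?_ ?_
  · intro p _
    have := p.2
    have := p.1.1.2
    simp only [Finset.mem_sigma, Finset.mem_range]
    omega
  · intro p _ q _ h
    simp only [Sigma.mk.injEq, heq_eq_eq] at h
    exact Subtype.ext (Prod.ext (Fin.ext h.1) (Fin.ext h.2))
  · rintro ⟨c, d⟩ h
    simp only [Finset.mem_sigma, Finset.mem_range] at h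
    exact ⟨⟨(⟨c, by omega⟩, ⟨d, by omega⟩), by simp; omega⟩, Finset.mem_univ _, rfl⟩
  · intro p _
    rfl

theorem pie_sum_swap (k : ℕ) (F : ℕ → ℕ → ℝ) : ∑ p : PieIndex k, F (p.1.2 : ℕ) (p.1.1 : ℕ) =
      ∑ c ∈ Finset.range (k + 1), ∑ d ∈ Finset.range (k + 1 - c), F c d := by
  rw [← pie_sum k F]
  refine Finset.sum_bij (fun p _ => ⟨(p.1.2, p.1.1), by have := p.2; simp; omega⟩) ?_ ?_ ?_ ?_
  · intro p _; exact Finset.mem_univ _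
  · intro p _ q _ h
    have h' := congrArg Subtype.val h
    simp only [Prod.mk.injEq] at h'
    exact Subtype.ext (Prod.ext h'.2 h'.1)
  · intro p _
    exact ⟨⟨(p.1.2, p.1.1), by have := p.2; simp; omega⟩, Finset.mem_univ _, rfl⟩
  · intro p _
    rfl

/-- Scaled version of the core bound. -/
theorem core_scaled {ι : Type*} [Fintype ι] (k : ℕ) (hk : 1 ≤ k) (f g : ι → ℕ)
    (H : ∀ F : ℕ → ℕ → ℝ, ∑ p, F (f p) (g p) =
      ∑ c ∈ Finset.range (k + 1), ∑ d ∈ Finset.range (k + 1 - c), F c d)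
    (x : ℝ) (hx : x ∈ Set.Icc (0:ℝ) (1/2)) (hroot : x ^ 3 - x + 1/3 = 0)
    (U : Finset ι) (hU : U ≠ ∅) (β : ℝ)
    (hab : savg (fun p => (f p : ℝ) / k) U ≤ β)
    (h2 : ∀ p, savg (fun p => (f p : ℝ) / k) U < (f p : ℝ) / k → p ∈ U)
    (h3 : ∀ p ∈ U, savg (fun p => (f p : ℝ) / k) U ≤ (f p : ℝ) / k ∨ β ≤ (g p : ℝ) / k) :
    x - 1 / k ≤ savg (fun p => (f p : ℝ) / k) U := by
  have hk0 : (0:ℝ) < k := by exact_mod_cast hk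
  have hs := savg_sum_sub (fun p => (f p : ℝ) / k) U hU
  have hn := savg_nonneg (fun p => (f p : ℝ) / k) (fun p => by positivity) U
  generalize savg (fun p => (f p : ℝ) / k) U = u at *
  have := core_bound k hk f g H x hx hroot U (u * k) (β * k) (by positivity)
    (mul_le_mul_of_nonneg_right hab hk0.le) (by
      have e : ∑ p ∈ U, ((f p : ℝ) - u * k) = k * ∑ p ∈ U, ((f p : ℝ) / k - u) := by
        rw [Finset.mul_sum]
        apply Finset.sum_congr rfl
        intro p _
        field_simp
      rw [e, hs, mul_zero])
    (fun p hp => h2 p (by rwa [lt_div_iff₀ hk0]))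
    (fun p hp => by
      rw [← le_div_iff₀ hk0, ← le_div_iff₀ hk0]; exact h3 p hp)
  rw [sub_le_iff_le_add]
  have e : u + 1 / k = (u * k + 1) / k := by field_simp
  rw [e, le_div_iff₀ hk0]
  linarith

/-- Elementary geometry of the segment. -/
theorem seg_close (x o₁ o₂ ε : ℝ) (hx : x ∈ Set.Icc (0:ℝ) (1/2)) (hε : 0 ≤ ε)
    (hsum : o₁ + o₂ ≤ 1) (hsum' : 1 - 2 * ε ≤ o₁ + o₂) (h1 : x - ε ≤ o₁) (h2 : x - ε ≤ o₂) :
    ∃ p ∈ segment ℝ ((x, 1 - x) : ℝ × ℝ) ((1 - x, x) : ℝ × ℝ),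
      max |o₁ - p.1| |o₂ - p.2| ≤ ε := by
  obtain ⟨hx0, hx1⟩ := hx
  obtain ⟨s, hs1, hs2, hs3, hs4⟩ : ∃ s, x ≤ s ∧ s ≤ 1 - x ∧ |o₁ - s| ≤ ε ∧ |o₂ - (1 - s)| ≤ ε := by
    refine ⟨max x (1 - o₂ - ε), le_max_left _ _, max_le (by linarith) (by linarith), ?_, ?_⟩
    · rw [abs_le]
      rcases max_cases x (1 - o₂ - ε) with ⟨h, h'⟩ | ⟨h, h'⟩ <;> rw [h] <;>
        constructor <;> linarith
    · rw [abs_le]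
      rcases max_cases x (1 - o₂ - ε) with ⟨h, h'⟩ | ⟨h, h'⟩ <;> rw [h] <;>
        constructor <;> linarith
  refine ⟨(s, 1 - s), ?_, max_le hs3 hs4⟩
  by_cases hh : x = 1 / 2
  · have : s = x := by linarith
    rw [this]
    exact left_mem_segment _ _ _
  · have hpos : 0 < 1 - 2 * x := by
      have := lt_of_le_of_ne hx1 hh
      linarith
    have hne := hpos.ne'
    refine ⟨(1 - x - s) / (1 - 2 * x), (s - x) / (1 - 2 * x), ?_, ?_, ?_, ?_⟩
    · exact div_nonneg (by linarith) hpos.le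
    · exact div_nonneg (by linarith) hpos.le
    · rw [← add_div, div_eq_one_iff_eq hne]; ring
    · ext
      · simp only [Prod.fst_add, Prod.smul_fst, Prod.snd_add, Prod.smul_snd, smul_eq_mul]
        rw [div_mul_eq_mul_div, div_mul_eq_mul_div, ← add_div, div_eq_iff hne]; ring
      · simp only [Prod.fst_add, Prod.smul_fst, Prod.snd_add, Prod.smul_snd, smul_eq_mul]
        rw [div_mul_eq_mul_div, div_mul_eq_mul_div, ← add_div, div_eq_iff hne]; ring

/-- In the splitting-the-pie example, every pure Nash equilibrium outcome of
`Γ_{SA_δ}(A(k))` is within `δ + 1/k` of the segment joining `(x, 1-x)` and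
`(1-x, x)`, where `x` is the unique root of `x³ - x + 1/3` in `[0, 1/2]`. -/
theorem splitting_the_pie
    (k : ℕ) (hk : 1 ≤ k) (δ : ℝ) (hδ0 : 0 < δ) (hδ1 : δ ≤ 1)
    (x : ℝ) (hx : x ∈ Set.Icc (0:ℝ) (1/2)) (hroot : x ^ 3 - x + 1/3 = 0)
    (L₁ L₂ : Finset (PieIndex k)) (hNE : IsPureNE (pieColl k) δ L₁ L₂) :
    ∃ p ∈ segment ℝ ((x, 1 - x) : ℝ × ℝ) ((1 - x, x) : ℝ × ℝ),
      max |(SAout (pieColl k) δ L₁ L₂).1 - p.1|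
          |(SAout (pieColl k) δ L₁ L₂).2 - p.2| ≤ δ + 1 / k := by
  have hk0 : (0:ℝ) < k := by exact_mod_cast hk
  obtain ⟨hN1, hN2⟩ := hNE
  simp only [SAout_fst, SAout_snd] at hN1 hN2 ⊢
  have hv0 : ∀ p : PieIndex k, 0 ≤ (pieColl k p).1 := fun p => by unfold pieColl; positivity
  have hw0 : ∀ p : PieIndex k, 0 ≤ (pieColl k p).2 := fun p => by unfold pieColl; positivity
  have hvw : ∀ p : PieIndex k, (pieColl k p).1 + (pieColl k p).2 ≤ 1 := fun p => by
    unfold pieColl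
    have := p.2
    simp only
    rw [← add_div, div_le_one hk0]
    exact_mod_cast this
  have hwv : ∀ p : PieIndex k, (pieColl k p).2 + (pieColl k p).1 ≤ 1 := fun p => by
    rw [add_comm]; exact hvw p
  obtain ⟨P, hP⟩ : ∃ P : PieIndex k, (pieColl k P).1 = 1 :=
    ⟨⟨(⟨k, by omega⟩, ⟨0, by omega⟩), by simp⟩, by simp [pieColl, hk0.ne']⟩
  obtain ⟨Q, hQ⟩ : ∃ Q : PieIndex k, (pieColl k Q).2 = 1 :=
    ⟨⟨(⟨0, by omega⟩, ⟨k, by omega⟩), by simp⟩, by simp [pieColl, hk0.ne']⟩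
  have hs := sval_add_le _ _ hvw δ hδ0 hδ1 L₁ L₂
  have ho1 := sval_nonneg _ hv0 δ hδ0 hδ1 L₁ L₂
  have ho2 := sval_nonneg _ hw0 δ hδ0 hδ1 L₂ L₁
  have hinv : 0 < 1 / (k:ℝ) := by positivity
  have hx' := hx
  obtain ⟨hx0, hx1⟩ := hx'
  rcases eq_or_lt_of_le hδ1 with hδ | hδ
  · exact seg_close x _ _ _ hx (by linarith) hs (by linarith) (by linarith) (by linarith)
  have hne2 : L₂ ≠ ∅ := T_nonempty _ _ hw0 hvw δ hδ0 hδ1 L₁ L₂ P Q hP (by rw [hQ]; norm_num) hN1 hN2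
  have hne1 : L₁ ≠ ∅ := T_nonempty _ _ hv0 hwv δ hδ0 hδ1 L₂ L₁ Q P hQ (by rw [hP]; norm_num) hN2 hN1
  obtain ⟨a1, a2, a3, a4⟩ := best_response _ δ hδ0 hδ L₁ L₂ hne2 hN1
  obtain ⟨b1, b2, b3, b4⟩ := best_response _ δ hδ0 hδ L₂ L₁ hne1 hN2
  have hUne : L₁ ∪ L₂ ≠ ∅ := fun h => hne1 (Finset.union_eq_empty.1 h).1
  have hz1 : 0 ≤ swt (fun p => (pieColl k p).1) L₁ L₂ := swt_nonneg _ hv0 _ _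
  have hz2 : 0 ≤ swt (fun p => (pieColl k p).2) L₂ L₁ := swt_nonneg _ hw0 _ _
  unfold sval at hs ⊢
  rw [Finset.union_comm L₂ L₁] at *
  rw [if_neg hUne, if_neg hUne] at *
  have d1 : ∀ p ∈ L₁ ∪ L₂, savg (fun p => (pieColl k p).1) (L₁ ∪ L₂) ≤ (pieColl k p).1 ∨
      savg (fun p => (pieColl k p).2) (L₁ ∪ L₂) ≤ (pieColl k p).2 := by
    intro p hp
    rcases Finset.mem_union.1 hp with h | h
    · exact Or.inl (a3 p h)
    · exact Or.inr (b3 p h)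
  have key : x - 1 / k ≤ savg (fun p => (pieColl k p).1) (L₁ ∪ L₂) ∧
      x - 1 / k ≤ savg (fun p => (pieColl k p).2) (L₁ ∪ L₂) := by
    rcases le_total (savg (fun p => (pieColl k p).1) (L₁ ∪ L₂))
      (savg (fun p => (pieColl k p).2) (L₁ ∪ L₂)) with h | h
    · have := core_scaled k hk (fun p : PieIndex k => (p.1.1 : ℕ)) (fun p => (p.1.2 : ℕ))
        (pie_sum k) x hx hroot _ hUne _ h a2 d1
      exact ⟨this, le_trans this h⟩
    · have := core_scaled k hk (fun p : PieIndex k => (p.1.2 : ℕ)) (fun p => (p.1.1 : ℕ))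
        (pie_sum_swap k) x hx hroot _ hUne _ h b2 (fun p hp => (d1 p hp).symm)
      exact ⟨le_trans this h, this⟩
  have hnone : ∀ p : PieIndex k, ¬ (swt (fun p => (pieColl k p).1) L₁ L₂ < (pieColl k p).1 ∧
      swt (fun p => (pieColl k p).2) L₂ L₁ < (pieColl k p).2) := by
    rintro p ⟨h1, h2⟩
    rcases Finset.mem_union.1 (a2 p (lt_of_le_of_lt a1 h1)) with h | h
    · exact absurd (b4 p h) (not_le.2 h2)
    · exact absurd (a4 p h) (not_le.2 h1)
  have hsumw : 1 - 1 / k ≤ swt (fun p => (pieColl k p).1) L₁ L₂ +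
      swt (fun p => (pieColl k p).2) L₂ L₁ := by
    generalize swt (fun p => (pieColl k p).1) L₁ L₂ = w1 at *
    generalize swt (fun p => (pieColl k p).2) L₂ L₁ = w2 at *
    have f1 := Nat.floor_le (show 0 ≤ w1 * k by positivity)
    have f2 := Nat.floor_le (show 0 ≤ w2 * k by positivity)
    have g1 := Nat.lt_floor_add_one (w1 * k)
    have g2 := Nat.lt_floor_add_one (w2 * k)
    have hcd : k + 1 ≤ (⌊w1 * k⌋₊ + 1) + (⌊w2 * k⌋₊ + 1) := by
      by_contra hc
      refine hnone ⟨(⟨⌊w1 * k⌋₊ + 1, by omega⟩, ⟨⌊w2 * k⌋₊ + 1, by omega⟩), by simp; omega⟩ ⟨?_, ?_⟩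
      · simp only [pieColl]
        rw [lt_div_iff₀ hk0]; push_cast; exact g1
      · simp only [pieColl]
        rw [lt_div_iff₀ hk0]; push_cast; exact g2
    have hcd' : (k:ℝ) + 1 ≤ (⌊w1 * k⌋₊ + 1) + (⌊w2 * k⌋₊ + 1) := by exact_mod_cast hcd
    have e : 1 - 1 / (k:ℝ) = (k - 1) / k := by field_simp
    rw [e, div_le_iff₀ hk0]
    linarith
  have hu1 := savg_nonneg _ hv0 (L₁ ∪ L₂)
  have hu2 := savg_nonneg _ hw0 (L₁ ∪ L₂)
  obtain ⟨k1, k2⟩ := key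
  generalize swt (fun p => (pieColl k p).1) L₁ L₂ = w1 at *
  generalize swt (fun p => (pieColl k p).2) L₂ L₁ = w2 at *
  generalize savg (fun p => (pieColl k p).1) (L₁ ∪ L₂) = u1 at *
  generalize savg (fun p => (pieColl k p).2) (L₁ ∪ L₂) = u2 at *
  generalize 1 / (k:ℝ) = r at *
  exact seg_close x _ _ _ hx (by linarith) hs (by nlinarith) (by nlinarith) (by nlinarith)
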